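/- For CNF formulas F and G with F ⊆ G: if F is a pseudo-factor of G with clause interpolant C, then F' := {D ∪ C : D ∈ F, D ∪ C non-tautological} satisfies F' ⊨ C, and hence F' ∪ (G \ F) is unsatisfiable. -/

import Mathlib

/-- A literal: a variable (natural number) with a polarity. -/
abbrev Lit : Type := ℕ × Bool

/-- Negation of a literal. -/
def Lit.neg (ℓ : Lit) : Lit := (ℓ.1, !ℓ.2)

/-- A clause: a finite set of literals. -/
abbrev Clause : Type := Finset Lit

/-- A clause is non-tautological: it contains no literal together with its negation. -/
def Clause.NonTaut (C : Clause) : Prop := ∀ ℓ ∈ C, Lit.neg ℓ ∉ C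

/-- A CNF formula: a finite set of clauses. -/
abbrev CNF : Type := Finset Clause

/-- A CNF formula is well-formed if all of its clauses are non-tautological. -/
def CNF.WellFormed (F : CNF) : Prop := ∀ C ∈ F, C.NonTaut

/-- A (total) assignment `τ` satisfies a literal. -/
def SatLit (τ : ℕ → Bool) (ℓ : Lit) : Prop := τ ℓ.1 = ℓ.2

/-- An assignment satisfies a clause if it satisfies some literal of it. -/
def SatClause (τ : ℕ → Bool) (C : Clause) : Prop := ∃ ℓ ∈ C, SatLit τ ℓ

/-- An assignment satisfies a CNF formula if it satisfies all of its clauses. -/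
def SatCNF (τ : ℕ → Bool) (F : CNF) : Prop := ∀ C ∈ F, SatClause τ C

/-- A CNF formula is unsatisfiable if no assignment satisfies it. -/
def Unsat (F : CNF) : Prop := ¬ ∃ τ : ℕ → Bool, SatCNF τ F

/-- `F` entails `G`: every model of `F` is a model of `G`. -/
def Entails (F G : CNF) : Prop := ∀ τ : ℕ → Bool, SatCNF τ F → SatCNF τ G

/-- Logical equivalence of CNF formulas. -/
def Equivalent (F G : CNF) : Prop := Entails F G ∧ Entails G F

/-- Two clauses clash: one contains a literal whose negation is in the other. -/
def Clash (C D : Clause) : Prop := ∃ ℓ ∈ C, Lit.neg ℓ ∈ D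

/-- A formula is hitting if every pair of distinct clauses clashes. -/
def Hitting (F : CNF) : Prop := ∀ C ∈ F, ∀ D ∈ F, C ≠ D → Clash C D

/-- The set of variables occurring in a CNF formula. -/
def cnfVars (F : CNF) : Finset ℕ := F.sup fun C => C.image Prod.fst

/-- `D` is the resolvent of `C₁` and `C₂` (on the unique clashing literal `ℓ`). -/
def Resolvent (C₁ C₂ D : Clause) : Prop :=
  ∃ ℓ : Lit, C₁ ∩ C₂.image Lit.neg = {ℓ} ∧ D = (C₁ ∪ C₂) \ {ℓ, Lit.neg ℓ}

/-- `L` is a resolution refutation of `F`: every clause of the sequence is an axiom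
(clause of `F`) or a resolvent of two earlier clauses, and the last clause is empty. -/
def IsRefutation (F : CNF) (L : List Clause) : Prop :=
  L ≠ [] ∧ L.getLast? = some (∅ : Clause) ∧
    ∀ i < L.length, L.getD i ∅ ∈ F ∨
      ∃ j k, j < i ∧ k < i ∧ Resolvent (L.getD j ∅) (L.getD k ∅) (L.getD i ∅)

/-- Resolution hardness: the minimum length of a resolution refutation. -/
noncomputable def hardness (F : CNF) : ℕ :=
  sInf {n | ∃ L : List Clause, IsRefutation F L ∧ L.length = n}

/-- The restriction `F[¬C]`: the result of setting all literals of `C` to 0 in `F`. -/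
def restrictByNegC (F : CNF) (C : Clause) : CNF :=
  (F.filter fun D => ∀ ℓ ∈ C, Lit.neg ℓ ∉ D).image fun D => D \ C

/-- `C` is a clause interpolant of `(F, H)`: `F ⊨ C` and `{C} ∪ H` is unsatisfiable. -/
def ClauseInterpolant (C : Clause) (F H : CNF) : Prop :=
  C.NonTaut ∧ Entails F {C} ∧ Unsat (insert C H)

/-- `F` is a factor of `G`: a subset of `G` logically equivalent to a single clause. -/
def IsFactor (F G : CNF) : Prop :=
  F ⊆ G ∧ ∃ C : Clause, C.NonTaut ∧ Equivalent F {C}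

/-- `F` is a pseudo-factor of `G`: `(F, G \ F)` has a clause interpolant. -/
def IsPseudoFactor (F G : CNF) : Prop :=
  F ⊆ G ∧ ∃ C : Clause, ClauseInterpolant C F (G \ F)

/-- `G` is irreducible: every factor has size 1 or `|G|`. -/
def CNF.Irreducible (G : CNF) : Prop :=
  ∀ F : CNF, IsFactor F G → F.card = 1 ∨ F.card = G.card

/-- `G` is strongly irreducible: every pseudo-factor has size 1 or `|G|`. -/
def StronglyIrreducible (G : CNF) : Prop :=
  ∀ F : CNF, IsPseudoFactor F G → F.card = 1 ∨ F.card = G.card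

/-- `F` is minimally unsatisfiable: unsatisfiable, but every proper subset is satisfiable. -/
def MinimallyUnsat (F : CNF) : Prop :=
  Unsat F ∧ ∀ G : CNF, G ⊂ F → ∃ τ : ℕ → Bool, SatCNF τ G

instance : DecidablePred Clause.NonTaut := fun C =>
  decidable_of_iff (∀ ℓ ∈ C, Lit.neg ℓ ∉ C) Iff.rfl

/-- The formula `F' = {D ∪ C : D ∈ F, D ∪ C non-tautological}`. -/
def addBasis (F : CNF) (C : Clause) : CNF :=
  (F.filter fun D => Clause.NonTaut (D ∪ C)).image fun D => D ∪ C

/-- Every assignment satisfies a tautological clause. -/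
theorem satClause_of_not_nonTaut (τ : ℕ → Bool) {C : Clause} (h : ¬ C.NonTaut) :
    SatClause τ C := by
  unfold Clause.NonTaut at h
  push Not at h
  obtain ⟨ℓ, hℓ, hneg⟩ := h
  by_cases hs : SatLit τ ℓ
  · exact ⟨ℓ, hℓ, hs⟩
  · exact ⟨Lit.neg ℓ, hneg, Bool.eq_not.mpr hs⟩

/-- A model satisfies a union of clauses iff it satisfies one of them. -/
theorem satClause_union {τ : ℕ → Bool} {C D : Clause} :
    SatClause τ (D ∪ C) ↔ SatClause τ D ∨ SatClause τ C := by
  simp only [SatClause, Finset.mem_union, or_and_right, exists_or]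

/-- A model of `addBasis F C` satisfies `D ∪ C` for every clause `D` of `F`. -/
theorem satClause_union_of_satCNF_addBasis {τ : ℕ → Bool} {F : CNF} {C D : Clause}
    (h : SatCNF τ (addBasis F C)) (hD : D ∈ F) : SatClause τ (D ∪ C) := by
  by_cases hn : Clause.NonTaut (D ∪ C)
  · exact h _ (Finset.mem_image_of_mem _ (Finset.mem_filter.mpr ⟨hD, hn⟩))
  · exact satClause_of_not_nonTaut τ hn

/-- If `F` entails the clause `C`, then so does `addBasis F C`. -/
theorem Entails.addBasis {F : CNF} {C : Clause} (h : Entails F {C}) :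
    Entails (addBasis F C) {C} := by
  intro τ hτ
  by_cases hC : SatClause τ C
  · simpa [SatCNF] using hC
  · exact h τ fun D hD =>
      (satClause_union.mp (satClause_union_of_satCNF_addBasis hτ hD)).resolve_right hC

/-- if `F ⊆ G` is a pseudo-factor of `G` with clause interpolant `C`,
then `F' := {D ∪ C : D ∈ F, D ∪ C non-tautological}` entails `C`, and hence
`F' ∪ (G \ F)` is unsatisfiable. -/
theorem add_basis_entails (G F : CNF) (C : Clause) (hwf : G.WellFormed) (hFG : F ⊆ G)
    (hint : ClauseInterpolant C F (G \ F)) :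
    Entails (addBasis F C) {C} ∧ Unsat (addBasis F C ∪ (G \ F)) := by
  have hC := hint.2.1.addBasis
  refine ⟨hC, fun ⟨τ, hτ⟩ => hint.2.2 ⟨τ, fun D hD => ?_⟩⟩
  rcases Finset.mem_insert.mp hD with rfl | hD
  · exact hC τ (fun E hE => hτ E (Finset.mem_union_left _ hE)) D (Finset.mem_singleton_self D)
  · exact hτ D (Finset.mem_union_right _ hD)
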